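/- Let n ≥ 2, r = (n+1)/gcd(n+1, 2), M_r = {t ∈ ℕ^n : r divides Σ_{i=1}^n i·t_i}, and for k ∈ K := {k : 2 ≤ k ≤ n, k ≠ r} set d_k = r − k if k < r and d_k = 2r − k if k > r, and e(k) = d_k·e_1 + e_k. Suppose t ∈ M_r is irreducible, t is not single (t has at least two nonzero coordinates), and t is not special (t ≠ e(k) for every k ∈ K). Then: (i) if r ≤ n then t_r = 0; (ii) r divides N := (Σ_{k ∈ K} d_k·t_k) − t_1 and the integer ‖t‖ := N/r is positive; and (iii) t + ‖t‖·(r·e_1) = Σ_{k ∈ K} t_k·e(k) in ℕ^n. -/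

import Mathlib

/-- An element `t` of a submonoid `M` of `ℕ^n` is irreducible (minimal) if `t ≠ 0`
and `t` is not the sum of two nonzero elements of `M`. -/
def IsIrredIn {n : ℕ} (M : Set (Fin n → ℕ)) (t : Fin n → ℕ) : Prop :=
  t ∈ M ∧ t ≠ 0 ∧ ¬ ∃ u v : Fin n → ℕ, u ∈ M ∧ v ∈ M ∧ u ≠ 0 ∧ v ≠ 0 ∧ t = u + v

/-- The `i`-th standard basis vector of `ℕ^n`. -/
def eN {n : ℕ} (i : Fin n) : Fin n → ℕ := Pi.single i 1

/-- `r = (n+1)/gcd(n+1, 2)`. -/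
def rA (n : ℕ) : ℕ := (n + 1) / Nat.gcd (n + 1) 2

/-- The monoid `M_r = Ψ` of type `A_n` in fundamental-weight coordinates:
`{t ∈ ℕ^n : r ∣ Σ i·t_i}` (1-based indices `i`). -/
def MrA (n : ℕ) : Set (Fin n → ℕ) := {t | rA n ∣ ∑ i, (i.val + 1) * t i}

/-- `d_k = r - k` if `k < r`, and `d_k = 2r - k` if `k > r` (for `k ≠ r`). -/
def dkA (n k : ℕ) : ℕ := if k < rA n then rA n - k else 2 * rA n - k

lemma rA_bounds {n : ℕ} (hn : 2 ≤ n) : 2 ≤ rA n ∧ n < 2 * rA n := by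
  unfold rA
  rcases (Nat.dvd_prime Nat.prime_two).1 (Nat.gcd_dvd_right (n + 1) 2) with h | h
  · rw [h, Nat.div_one]
    omega
  · have h2 : 2 ∣ n + 1 := h ▸ Nat.gcd_dvd_left (n + 1) 2
    rw [h]
    omega

lemma rA_dvd_dkA_add {n k : ℕ} (hk : k ≤ 2 * rA n) : rA n ∣ dkA n k + k := by
  unfold dkA
  split_ifs with h
  · rw [Nat.sub_add_cancel h.le]
  · rw [Nat.sub_add_cancel hk]
    exact dvd_mul_left _ _

lemma sum_mul_eN {n : ℕ} (k : Fin n) : ∑ i : Fin n, (i.val + 1) * eN k i = k.val + 1 := by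
  simp [eN, Pi.single_apply]

lemma smul_eN_add_eN_mem_MrA {n : ℕ} (i k : Fin n) (d : ℕ)
    (h : rA n ∣ d * (i.val + 1) + (k.val + 1)) : d • eN i + eN k ∈ MrA n := by
  have : ∑ j : Fin n, (j.val + 1) * (d • eN i + eN k) j = d * (i.val + 1) + (k.val + 1) := by
    rw [← sum_mul_eN i, ← sum_mul_eN k, Finset.mul_sum, ← Finset.sum_add_distrib]
    refine Finset.sum_congr rfl fun j _ => ?_
    simp only [Pi.add_apply, Pi.smul_apply, smul_eq_mul]
    ring
  change rA n ∣ _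
  rwa [this]

lemma IsIrredIn.eq_of_le {n : ℕ} {t u : Fin n → ℕ} (ht : IsIrredIn (MrA n) t)
    (hu : u ∈ MrA n) (hu0 : u ≠ 0) (hle : u ≤ t) : t = u := by
  by_contra hne
  have hadd : t = u + (t - u) := (add_tsub_cancel_of_le hle).symm
  refine ht.2.2 ⟨u, t - u, hu, ?_, hu0, fun h => hne (by rw [hadd, h, add_zero]), hadd⟩
  have htM : rA n ∣ ∑ i, (i.val + 1) * t i := ht.1
  rw [hadd] at htM
  simp only [Pi.add_apply, mul_add, Finset.sum_add_distrib] at htM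
  exact (Nat.dvd_add_right hu).1 htM

lemma eN_apply {n : ℕ} (k i : Fin n) : eN k i = if i = k then 1 else 0 := by
  simp [eN, Pi.single_apply]

lemma IsIrredIn.apply_eq_zero {n : ℕ} {t : Fin n → ℕ} (ht : IsIrredIn (MrA n) t)
    (hns : ∃ i j : Fin n, i ≠ j ∧ t i ≠ 0 ∧ t j ≠ 0) (k : Fin n) (hk : k.val + 1 = rA n) :
    t k = 0 := by
  by_contra h0
  have hmem : eN k ∈ MrA n := by
    simpa using smul_eN_add_eN_mem_MrA k k 0 (by simp [hk])
  have hte : t = eN k := by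
    refine ht.eq_of_le hmem (fun h => ?_) fun i => ?_
    · simpa [eN_apply] using congrFun h k
    · rw [eN_apply]
      split_ifs with h
      · subst h
        exact Nat.one_le_iff_ne_zero.2 h0
      · exact Nat.zero_le _
  obtain ⟨i, j, hij, hi, hj⟩ := hns
  rw [hte, eN_apply] at hi hj
  simp only [ne_eq, ite_eq_right_iff, one_ne_zero, imp_false, not_not] at hi hj
  exact hij (hi.trans hj.symm)

lemma IsIrredIn.lt_dkA {n : ℕ} (hn : 2 ≤ n) (h₀ : 0 < n) {t : Fin n → ℕ} (ht : IsIrredIn (MrA n) t)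
    (k : Fin n) (hk : 1 ≤ k.val)
    (hne : t ≠ dkA n (k.val + 1) • eN ⟨0, h₀⟩ + eN k) (hk0 : t k ≠ 0) :
    t ⟨0, h₀⟩ < dkA n (k.val + 1) := by
  by_contra! hle
  have hb := rA_bounds hn
  refine hne (ht.eq_of_le (smul_eN_add_eN_mem_MrA _ _ _ ?_) (fun h => ?_) fun i => ?_)
  · simpa using rA_dvd_dkA_add (n := n) (k := k.val + 1) (by omega)
  · simpa [eN_apply] using congrFun h k
  · simp only [Pi.add_apply, Pi.smul_apply, smul_eq_mul, eN_apply, Fin.ext_iff]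
    by_cases hi : i.val = 0
    · rw [show i = ⟨0, h₀⟩ from Fin.ext hi]
      simpa [show ¬ 0 = k.val by omega] using hle
    · by_cases hik : i = k
      · subst hik
        simp [hi]
        omega
      · simp [hi, Fin.val_ne_iff.2 hik]

lemma rA_dvd_sum_dkA_sub {n : ℕ} (hn : 2 ≤ n) (h₀ : 0 < n) {t : Fin n → ℕ} (ht : t ∈ MrA n) :
    (rA n : ℤ) ∣ (∑ k : Fin n, if 1 ≤ k.val ∧ k.val + 1 ≠ rA n
      then (dkA n (k.val + 1) * t k : ℤ) else 0) - (t ⟨0, h₀⟩ : ℤ) := by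
  have hb := rA_bounds hn
  have ht0 : (t ⟨0, h₀⟩ : ℤ) =
      ∑ k : Fin n, if k = ⟨0, h₀⟩ then (t k : ℤ) else 0 := by simp
  have hw : (rA n : ℤ) ∣ ∑ k : Fin n, ((k.val + 1 : ℕ) : ℤ) * t k := by
    exact_mod_cast (show rA n ∣ ∑ i : Fin n, (i.val + 1) * t i from ht)
  rw [ht0, ← Finset.sum_sub_distrib, ← dvd_add_left hw, ← Finset.sum_add_distrib]
  refine Finset.dvd_sum fun k _ => ?_
  by_cases hk0 : k.val = 0
  · simp [Fin.ext_iff, hk0]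
  · by_cases hkr : k.val + 1 = rA n
    · simp [Fin.ext_iff, hk0, hkr]
    · have hd : (rA n : ℤ) ∣ (dkA n (k.val + 1) : ℤ) + ((k.val + 1 : ℕ) : ℤ) := by
        exact_mod_cast rA_dvd_dkA_add (n := n) (k := k.val + 1) (by omega)
      rw [if_pos ⟨by omega, hkr⟩, if_neg (by simpa [Fin.ext_iff] using hk0), sub_zero, ← add_mul]
      exact hd.mul_right _

/-- Let `t ∈ M_r` be irreducible, not single (at least two nonzero coordinates), and not
special (`t ≠ e(k) = d_k·e_1 + e_k` for all `k ∈ K = {k : 2 ≤ k ≤ n, k ≠ r}`). Then: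
(i) if `r ≤ n` then `t_r = 0`; (ii) `N = (Σ_{k ∈ K} d_k·t_k) - t_1` is a positive multiple
`m·r` of `r`; (iii) `t + m·(r·e_1) = Σ_{k ∈ K} t_k·e(k)` in `ℕ^n`. -/
theorem typeA_ordinary_decomposition (n : ℕ) (hn : 2 ≤ n) (t : Fin n → ℕ)
    (hirr : IsIrredIn (MrA n) t)
    (hnotsingle : ∃ i j : Fin n, i ≠ j ∧ t i ≠ 0 ∧ t j ≠ 0)
    (hnotspecial : ∀ k : Fin n, 1 ≤ k.val → k.val + 1 ≠ rA n →
      t ≠ dkA n (k.val + 1) • eN ⟨0, by omega⟩ + eN k) :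
    (∀ _ : rA n ≤ n, t ⟨rA n - 1, by omega⟩ = 0) ∧
    ∃ m : ℕ, 0 < m ∧
      (∑ k : Fin n, if 1 ≤ k.val ∧ k.val + 1 ≠ rA n
          then (dkA n (k.val + 1) * t k : ℤ) else 0) - (t ⟨0, by omega⟩ : ℤ) =
        (m : ℤ) * (rA n : ℤ) ∧
      t + m • (rA n • eN ⟨0, by omega⟩) =
        ∑ k : Fin n, if 1 ≤ k.val ∧ k.val + 1 ≠ rA n
          then t k • (dkA n (k.val + 1) • eN ⟨0, by omega⟩ + eN k) else 0 := by
  have hb := rA_bounds hn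
  have hr := hirr.apply_eq_zero hnotsingle
  refine ⟨fun _ => hr _ (by simp only; omega), ?_⟩
  obtain ⟨k, hk1, hk0⟩ : ∃ k : Fin n, 1 ≤ k.val ∧ t k ≠ 0 := by
    obtain ⟨i, j, hij, hi, hj⟩ := hnotsingle
    by_cases h : 1 ≤ i.val
    · exact ⟨i, h, hi⟩
    · exact ⟨j, by have := Fin.val_ne_iff.2 hij; omega, hj⟩
  have hkr : k.val + 1 ≠ rA n := fun h => hk0 (hr k h)
  have hlt := hirr.lt_dkA hn _ k hk1 (hnotspecial k hk1 hkr) hk0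
  obtain ⟨c, hc⟩ := rA_dvd_sum_dkA_sub hn (by omega) hirr.1
  have hle : (dkA n (k.val + 1) * t k : ℤ) ≤ ∑ k : Fin n,
      if 1 ≤ k.val ∧ k.val + 1 ≠ rA n then (dkA n (k.val + 1) * t k : ℤ) else 0 := by
    refine le_trans (le_of_eq (if_pos ⟨hk1, hkr⟩).symm) (Finset.single_le_sum
      (f := fun k : Fin n => if 1 ≤ k.val ∧ k.val + 1 ≠ rA n
        then (dkA n (k.val + 1) * t k : ℤ) else 0) (fun i _ => ?_) (Finset.mem_univ k))
    split_ifs <;> positivity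
  have hpos : 0 < (rA n : ℤ) * c := by
    rw [← hc]
    have h1 : (dkA n (k.val + 1) : ℤ) ≤ dkA n (k.val + 1) * t k :=
      le_mul_of_one_le_right (by positivity) (by omega)
    omega
  have hcpos : 0 < c := pos_of_mul_pos_right hpos (by positivity)
  lift c to ℕ using hcpos.le
  refine ⟨c, by exact_mod_cast hcpos, by rw [hc, mul_comm], ?_⟩
  funext j
  rw [Finset.sum_apply]
  by_cases hj : j.val = 0
  · rw [show j = ⟨0, by omega⟩ from Fin.ext hj]
    have hsum : ∀ k : Fin n, (if 1 ≤ k.val ∧ k.val + 1 ≠ rA n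
        then t k • (dkA n (k.val + 1) • eN ⟨0, by omega⟩ + eN k) else 0 : Fin n → ℕ)
          ⟨0, by omega⟩ =
        if 1 ≤ k.val ∧ k.val + 1 ≠ rA n then dkA n (k.val + 1) * t k else 0 := by
      intro k
      split_ifs with h
      · have : ¬ 0 = k.val := by omega
        simp [eN_apply, Fin.ext_iff, this, mul_comm]
      · rfl
    rw [Finset.sum_congr rfl fun k _ => hsum k]
    simp only [Pi.add_apply, Pi.smul_apply, smul_eq_mul, eN_apply, if_true, mul_one]
    apply Nat.cast_injective (R := ℤ)
    simp only [Nat.cast_add, Nat.cast_mul, Nat.cast_sum, Nat.cast_ite, Nat.cast_zero]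
    linarith
  · rw [Finset.sum_eq_single j]
    · by_cases hjr : j.val + 1 = rA n
      · simp [hjr, hr j hjr, eN_apply, Fin.ext_iff, hj]
      · simp [hjr, eN_apply, Fin.ext_iff, hj, Nat.one_le_iff_ne_zero]
    · intro k _ hkj
      split_ifs
      · simp [eN_apply, Fin.ext_iff, hj, Fin.val_ne_iff.2 hkj.symm]
      · rfl
    · simp
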